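/- arXiv:2511.07869 — 5 statements merged into one kernel-verified Lean document; each statement's English description precedes it below -/
import Mathlib

section
/- Let n ≥ 2 and let X_1, …, X_n be jointly distributed random variables, each taking values in a finite set. Then (n−1)·H(X_1,…,X_n) ≤ Σ_{i=1}^n H(X_{[n]∖{i}}), where X_{[n]∖{i}} denotes the tuple of all variables except X_i. -/
open MeasureTheory

/-- Shannon entropy (natural log) of a finitely-valued random variable `f`
on the probability space `(Ω, μ)`: `H(f) = -∑ b P(f = b) log P(f = b)`. -/
noncomputable def fentropy {Ω β : Type*} [MeasurableSpace Ω] [Fintype β]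
    (μ : Measure Ω) (f : Ω → β) : ℝ :=
  ∑ b : β, Real.negMulLog ((μ (f ⁻¹' {b})).toReal)

/-- The law of a function of a finitely-valued random variable is a sum over fibres. -/
theorem measureReal_comp_preimage_singleton {Ω β γ : Type*} [MeasurableSpace Ω] [Fintype β]
    [DecidableEq γ] (μ : Measure Ω) [IsFiniteMeasure μ] (f : Ω → β)
    (hf : ∀ x, MeasurableSet (f ⁻¹' {x})) (u : β → γ) (y : γ) :
    μ.real ((fun ω => u (f ω)) ⁻¹' {y}) = ∑ x with u x = y, μ.real (f ⁻¹' {x}) := by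
  rw [← measureReal_biUnion_finset]
  · congr 1
    ext ω
    simp
  · intro x _ x' _ hne
    exact Set.disjoint_left.2 fun ω h h' => hne (h.symm.trans h')
  · exact fun x _ => hf x

/-- The entropy of `u ∘ f` as an expectation with respect to the law of `f`. -/
theorem fentropy_comp {Ω β γ : Type*} [MeasurableSpace Ω] [Fintype β] [Fintype γ]
    (μ : Measure Ω) [IsFiniteMeasure μ] (f : Ω → β)
    (hf : ∀ x, MeasurableSet (f ⁻¹' {x})) (u : β → γ) :
    fentropy μ (fun ω => u (f ω)) =
      ∑ x, -(μ.real (f ⁻¹' {x}) * Real.log (μ.real ((fun ω => u (f ω)) ⁻¹' {u x}))) := by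
  classical
  rw [← Finset.sum_fiberwise Finset.univ u]
  refine Finset.sum_congr rfl fun y _ => ?_
  change Real.negMulLog (μ.real _) = _
  rw [Real.negMulLog, neg_mul]
  nth_rewrite 1 [measureReal_comp_preimage_singleton μ f hf u y]
  rw [Finset.sum_mul, ← Finset.sum_neg_distrib]
  refine Finset.sum_congr rfl fun x hx => ?_
  rw [(Finset.mem_filter.1 hx).2]

/-- Submodularity of entropy: if `f` is determined by the pair `(a ∘ f, b ∘ f)`, and `c ∘ f` is a
function of each of `a ∘ f` and `b ∘ f`, then `H(f) + H(c ∘ f) ≤ H(a ∘ f) + H(b ∘ f)`. -/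
theorem fentropy_add_fentropy_le {Ω β A B C : Type*} [MeasurableSpace Ω]
    [Fintype β] [Fintype A] [Fintype B] [Fintype C]
    (μ : Measure Ω) [IsFiniteMeasure μ] (f : Ω → β) (hf : ∀ x, MeasurableSet (f ⁻¹' {x}))
    (a : β → A) (b : β → B) (r : A → C) (s : B → C) (hrs : ∀ x, r (a x) = s (b x))
    (hinj : Function.Injective fun x => (a x, b x)) :
    fentropy μ f + fentropy μ (fun ω => r (a (f ω))) ≤
      fentropy μ (fun ω => a (f ω)) + fentropy μ (fun ω => b (f ω)) := by
  classical
  have ha := fentropy_comp μ f hf a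
  have hb := fentropy_comp μ f hf b
  have hc := fentropy_comp μ f hf (fun x => r (a x))
  have hid := fentropy_comp μ f hf (fun x => x)
  set p : β → ℝ := fun x => μ.real (f ⁻¹' {x})
  set pa : A → ℝ := fun y => μ.real ((fun ω => a (f ω)) ⁻¹' {y})
  set pb : B → ℝ := fun y => μ.real ((fun ω => b (f ω)) ⁻¹' {y})
  set pc : C → ℝ := fun z => μ.real ((fun ω => r (a (f ω))) ⁻¹' {z}) with hpc
  have hma : ∀ y, MeasurableSet ((fun ω => a (f ω)) ⁻¹' {y}) := fun y => by
    have : (fun ω => a (f ω)) ⁻¹' {y} = ⋃ x ∈ a ⁻¹' {y}, f ⁻¹' {x} := by ext; simp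
    rw [this]
    exact (Set.toFinite _).measurableSet_biUnion fun x _ => hf x
  have hmb : ∀ y, MeasurableSet ((fun ω => b (f ω)) ⁻¹' {y}) := fun y => by
    have : (fun ω => b (f ω)) ⁻¹' {y} = ⋃ x ∈ b ⁻¹' {y}, f ⁻¹' {x} := by ext; simp
    rw [this]
    exact (Set.toFinite _).measurableSet_biUnion fun x _ => hf x
  have hsa : ∀ z, pc z = ∑ y with r y = z, pa y :=
    measureReal_comp_preimage_singleton μ _ hma r
  have hsb : ∀ z, pc z = ∑ y with s y = z, pb y := fun z => by
    rw [← measureReal_comp_preimage_singleton μ _ hmb s]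
    simp only [hpc, hrs]
  have hsp : ∑ z, pc z = ∑ x, p x := by
    rw [← Finset.sum_fiberwise Finset.univ fun x => r (a x)]
    exact Finset.sum_congr rfl fun z _ =>
      measureReal_comp_preimage_singleton μ f hf (fun x => r (a x)) z
  have key : ∑ x, pa (a x) * pb (b x) / pc (r (a x)) ≤ ∑ x, p x := by
    calc ∑ x, pa (a x) * pb (b x) / pc (r (a x))
        = ∑ y ∈ Finset.univ.image fun x => (a x, b x), pa y.1 * pb y.2 / pc (r y.1) := by
          rw [Finset.sum_image hinj.injOn]
      _ ≤ ∑ y : A × B with r y.1 = s y.2, pa y.1 * pb y.2 / pc (r y.1) := by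
          refine Finset.sum_le_sum_of_subset_of_nonneg ?_ fun y _ _ => by positivity
          intro y hy
          obtain ⟨x, -, rfl⟩ := Finset.mem_image.1 hy
          simpa using hrs x
      _ = ∑ y : A, pa y * pc (r y) / pc (r y) := by
          rw [Finset.sum_filter, Fintype.sum_prod_type]
          refine Finset.sum_congr rfl fun y _ => ?_
          nth_rewrite 1 [hsb]
          rw [Finset.mul_sum, Finset.sum_div, Finset.sum_filter]
          simp only [eq_comm]
      _ ≤ ∑ y : A, pa y := by
          refine Finset.sum_le_sum fun y _ => ?_
          rw [mul_div_assoc]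
          exact mul_le_of_le_one_right measureReal_nonneg (div_self_le_one _)
      _ = ∑ x, p x := by
          rw [← hsp, ← Finset.sum_fiberwise Finset.univ r]
          exact Finset.sum_congr rfl fun z _ => (hsa z).symm
  have pointwise : ∀ x, -(p x * Real.log (p x)) + -(p x * Real.log (pc (r (a x)))) ≤
      -(p x * Real.log (pa (a x))) + -(p x * Real.log (pb (b x))) +
        (pa (a x) * pb (b x) / pc (r (a x)) - p x) := fun x => by
    rcases (measureReal_nonneg : 0 ≤ p x).eq_or_lt with h0 | h0
    · have : 0 ≤ pa (a x) * pb (b x) / pc (r (a x)) := by positivity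
      have hp : p x = 0 := h0.symm
      rw [hp]
      linarith
    · have h1 : 0 < pa (a x) := h0.trans_le <| measureReal_mono fun ω h => congrArg a h
      have h2 : 0 < pb (b x) := h0.trans_le <| measureReal_mono fun ω h => congrArg b h
      have h3 : 0 < pc (r (a x)) :=
        h0.trans_le <| measureReal_mono fun ω h => congrArg (fun x => r (a x)) h
      have h := mul_le_mul_of_nonneg_left (Real.log_le_sub_one_of_pos
        (x := pa (a x) * pb (b x) / pc (r (a x)) / p x) (by positivity)) h0.le
      rw [Real.log_div (by positivity) h0.ne', Real.log_div (by positivity) h3.ne',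
        Real.log_mul h1.ne' h2.ne', mul_sub _ _ 1, mul_div_cancel₀ _ h0.ne'] at h
      linarith
  have := Finset.sum_le_sum fun x (_ : x ∈ Finset.univ) => pointwise x
  simp only [Finset.sum_add_distrib, Finset.sum_sub_distrib] at this
  change fentropy μ f = _ at hid
  rw [ha, hb, hc, hid]
  linarith

theorem fentropy_nonneg {Ω β : Type*} [MeasurableSpace Ω] [Fintype β]
    (μ : Measure Ω) [IsProbabilityMeasure μ] (f : Ω → β) : 0 ≤ fentropy μ f :=
  Finset.sum_nonneg fun _ _ => Real.negMulLog_nonneg measureReal_nonneg measureReal_le_one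

/-- A form of Han's inequality in which only the coordinates in `S` are left out in turn. -/
theorem card_sub_one_mul_fentropy_add_le {Ω ι : Type*} [MeasurableSpace Ω] [Fintype ι]
    [DecidableEq ι] (μ : Measure Ω) [IsFiniteMeasure μ]
    (α : ι → Type*) [∀ i, Fintype (α i)]
    [∀ i, MeasurableSpace (α i)] [∀ i, MeasurableSingletonClass (α i)]
    (X : ∀ i, Ω → α i) (hX : ∀ i, Measurable (X i)) (S : Finset ι) :
    (S.card - 1 : ℝ) * fentropy μ (fun ω i => X i ω) +
        fentropy μ (fun ω (j : {j // j ∈ Sᶜ}) => X j.1 ω) ≤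
      ∑ i ∈ S, fentropy μ (fun ω (j : {j // j ∈ Finset.univ.erase i}) => X j.1 ω) := by
  have hf : ∀ x, MeasurableSet ((fun ω i => X i ω) ⁻¹' {x}) := fun x =>
    measurable_pi_lambda _ hX (measurableSet_singleton x)
  induction S using Finset.induction_on with
  | empty =>
    have := fentropy_add_fentropy_le μ (fun ω i => X i ω) hf
      (fun x (j : {j // j ∈ (∅ : Finset ι)ᶜ}) => x j.1) (fun x => x) id
      (fun x (j : {j // j ∈ (∅ : Finset ι)ᶜ}) => x j.1) (fun _ => rfl)
      (fun x y h => (Prod.ext_iff.1 h).2)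
    have h2 := fentropy_add_fentropy_le μ
      (fun ω (j : {j // j ∈ (∅ : Finset ι)ᶜ}) => X j.1 ω)
      (fun x => measurable_pi_lambda _ (fun j => hX j.1) (measurableSet_singleton x))
      (fun x (i : ι) => x ⟨i, by simp⟩) (fun x (i : ι) => x ⟨i, by simp⟩) id id (fun _ => rfl)
      (fun x y h => funext fun j => congrFun (Prod.ext_iff.1 h).1 j.1)
    simp only [id] at this h2
    simp only [Finset.card_empty, Finset.sum_empty]
    push_cast
    linarith
  | insert i S hi ih =>
    have := fentropy_add_fentropy_le μ (fun ω i => X i ω) hf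
      (fun x (j : {j // j ∈ Finset.univ.erase i}) => x j.1)
      (fun x (j : {j // j ∈ Sᶜ}) => x j.1)
      (fun y (j : {j // j ∈ (insert i S)ᶜ}) => y ⟨j.1, by have := j.2; simp_all⟩)
      (fun y (j : {j // j ∈ (insert i S)ᶜ}) => y ⟨j.1, by have := j.2; simp_all⟩)
      (fun _ => rfl) (fun x y h => funext fun j => by
        obtain ⟨h1, h2⟩ := Prod.ext_iff.1 h
        by_cases hj : j = i
        · exact congrFun h2 ⟨j, by simpa [hj] using hi⟩
        · exact congrFun h1 ⟨j, by simp [hj]⟩)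
    rw [Finset.sum_insert hi, Finset.card_insert_of_notMem hi]
    push_cast
    linarith

/-- For `n ≥ 2` jointly distributed finitely-valued random variables
`X 0, …, X (n-1)`, we have `(n-1) · H(X_{[n]}) ≤ ∑ i H(X_{[n] \ {i}})`. -/
theorem han_inequality {Ω : Type*} [MeasurableSpace Ω] (μ : Measure Ω)
    [IsProbabilityMeasure μ] {n : ℕ} (hn : 2 ≤ n)
    (α : Fin n → Type*) [∀ i, Fintype (α i)]
    [∀ i, MeasurableSpace (α i)] [∀ i, MeasurableSingletonClass (α i)]
    (X : ∀ i, Ω → α i) (hX : ∀ i, Measurable (X i)) :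
    (n - 1 : ℝ) * fentropy μ (fun ω (i : Fin n) => X i ω) ≤
      ∑ i : Fin n,
        fentropy μ (fun ω (j : {j // j ∈ (Finset.univ : Finset (Fin n)).erase i}) => X j.1 ω) := by
  have h := card_sub_one_mul_fentropy_add_le μ α X hX Finset.univ
  rw [Finset.card_univ, Fintype.card_fin] at h
  have h0 := fentropy_nonneg μ
    (fun ω (j : {j // j ∈ (Finset.univ : Finset (Fin n))ᶜ}) => X j.1 ω)
  linarith
end

section
/- Let n ≥ 2 and let X_1, …, X_n be jointly distributed random variables, each taking values in a finite set. Then the total correlation D( law(X_1,…,X_n) ‖ law(X_1) ⊗ ⋯ ⊗ law(X_n) ) is at most the potential φ(X_{[n]}) = Σ_{i=1}^n I(X_i ; X_{[n]∖{i}}). -/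
open MeasureTheory

/-- Mutual information `I(f ; g) = H(f) + H(g) - H(f, g)`. -/
noncomputable def fmutualInfo {Ω β γ : Type*} [MeasurableSpace Ω] [Fintype β] [Fintype γ]
    (μ : Measure Ω) (f : Ω → β) (g : Ω → γ) : ℝ :=
  fentropy μ f + fentropy μ g - fentropy μ (fun ω => (f ω, g ω))

/-- The potential `φ(X_S) = ∑_{i ∈ S} I(X_i ; X_{S \ {i}})`. -/
noncomputable def fphi {Ω ι : Type*} [MeasurableSpace Ω] [DecidableEq ι]
    {α : ι → Type*} [∀ i, Fintype (α i)]
    (μ : Measure Ω) (X : ∀ i, Ω → α i) (S : Finset ι) : ℝ :=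
  ∑ i ∈ S, fmutualInfo μ (X i) (fun ω (j : {j // j ∈ S.erase i}) => X j.1 ω)

/-- Kullback–Leibler divergence `D(ν ‖ μ) = ∫ log (dν/dμ) dν`. -/
noncomputable def klDivR {β : Type*} [MeasurableSpace β] (ν μ : Measure β) : ℝ :=
  ∫ z, Real.log ((ν.rnDeriv μ z).toReal) ∂ν

section FiniteSums

variable {α β : Type*} [Fintype α] [Fintype β]

/-- Subadditivity of entropy for a nonnegative matrix, not necessarily of total mass one. -/
theorem sum_negMulLog_add_negMulLog_sum_le (p : α → β → ℝ) (hp : ∀ a b, 0 ≤ p a b) :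
    ∑ a, ∑ b, Real.negMulLog (p a b) + Real.negMulLog (∑ a, ∑ b, p a b) ≤
      ∑ a, Real.negMulLog (∑ b, p a b) + ∑ b, Real.negMulLog (∑ a, p a b) := by
  set r : α → ℝ := fun a => ∑ b, p a b
  set s : β → ℝ := fun b => ∑ a, p a b
  set t : ℝ := ∑ a, r a
  have hst : ∑ b, s b = t := Finset.sum_comm
  have hr0 : ∀ a, 0 ≤ r a := fun a => Finset.sum_nonneg fun b _ => hp a b
  have hs0 : ∀ b, 0 ≤ s b := fun b => Finset.sum_nonneg fun a _ => hp a b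
  have ht0 : 0 ≤ t := Finset.sum_nonneg fun a _ => hr0 a
  have hpr : ∀ a b, p a b ≤ r a := fun a b =>
    Finset.single_le_sum (f := p a) (fun b _ => hp a b) (Finset.mem_univ b)
  have hps : ∀ a b, p a b ≤ s b := fun a b =>
    Finset.single_le_sum (f := fun a => p a b) (fun a _ => hp a b) (Finset.mem_univ a)
  have hrt : ∀ a, r a ≤ t := fun a =>
    Finset.single_le_sum (fun a _ => hr0 a) (Finset.mem_univ a)
  have key : ∀ a b, p a b - r a * s b / t ≤
      p a b * (Real.log (p a b) + Real.log t - Real.log (r a) - Real.log (s b)) := by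
    intro a b
    rcases (hp a b).eq_or_lt with h | h
    · rw [← h]
      have : 0 ≤ r a * s b / t := by have := hr0 a; have := hs0 b; positivity
      linarith
    · have h1 : 0 < r a := h.trans_le (hpr a b)
      have h2 : 0 < s b := h.trans_le (hps a b)
      have h3 : 0 < t := h1.trans_le (hrt a)
      have h4 := Real.one_sub_inv_le_log_of_pos (x := p a b * t / (r a * s b)) (by positivity)
      rw [Real.log_div (by positivity) (by positivity), Real.log_mul h.ne' h3.ne',
        Real.log_mul h1.ne' h2.ne'] at h4
      have h5 := mul_le_mul_of_nonneg_left h4 h.le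
      have h6 : p a b * (1 - (p a b * t / (r a * s b))⁻¹) = p a b - r a * s b / t := by
        field_simp
      linarith
  have hsum : ∑ a, ∑ b, (p a b - r a * s b / t) = 0 := by
    have h1 : ∑ a, ∑ b, r a * s b / t = t * t / t := by
      simp_rw [← Finset.sum_div, ← Finset.mul_sum, hst, ← Finset.sum_mul]
      rfl
    simp_rw [Finset.sum_sub_distrib]
    rw [h1, mul_self_div_self]
    exact sub_self t
  have hle := Finset.sum_le_sum fun a (_ : a ∈ Finset.univ) =>
    Finset.sum_le_sum fun b (_ : b ∈ Finset.univ) => key a b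
  rw [hsum] at hle
  have e1 : ∑ a, ∑ b, p a b * Real.log t = t * Real.log t := by
    simp_rw [← Finset.sum_mul]
    rfl
  have e2 : ∑ a, ∑ b, p a b * Real.log (r a) = ∑ a, r a * Real.log (r a) := by
    simp_rw [← Finset.sum_mul]
    rfl
  have e3 : ∑ a, ∑ b, p a b * Real.log (s b) = ∑ b, s b * Real.log (s b) := by
    rw [Finset.sum_comm]
    simp_rw [← Finset.sum_mul]
    rfl
  simp_rw [mul_sub, mul_add, Finset.sum_sub_distrib, Finset.sum_add_distrib] at hle
  rw [e1, e2, e3] at hle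
  simp only [Real.negMulLog, neg_mul, Finset.sum_neg_distrib]
  linarith

end FiniteSums

theorem measureReal_preimage_eq_sum {Ω β γ : Type*} [MeasurableSpace Ω] {μ : Measure Ω}
    [IsProbabilityMeasure μ] [Fintype γ] [MeasurableSpace β] [MeasurableSpace γ]
    [MeasurableSingletonClass β] [MeasurableSingletonClass γ] {f : Ω → β} {g : Ω → γ}
    (hf : Measurable f) (hg : Measurable g) (b : β) :
    μ.real (f ⁻¹' {b}) = ∑ c, μ.real ((fun ω => (f ω, g ω)) ⁻¹' {(b, c)}) := by
  rw [← measureReal_biUnion_finset]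
  · congr 1
    ext ω
    simp
  · intro c _ c' _ hc
    refine Set.disjoint_left.2 fun ω h h' => hc ?_
    simp only [Set.mem_preimage, Set.mem_singleton_iff, Prod.mk.injEq] at h h'
    exact h.2.symm.trans h'.2
  · exact fun c _ => (hf.prodMk hg) (measurableSet_singleton _)

section Entropy

variable {Ω α β γ : Type*} [MeasurableSpace Ω] {μ : Measure Ω} [IsProbabilityMeasure μ]
  [Fintype α] [Fintype β] [Fintype γ]
  [MeasurableSpace α] [MeasurableSpace β] [MeasurableSpace γ]
  [MeasurableSingletonClass α] [MeasurableSingletonClass β] [MeasurableSingletonClass γ]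

theorem integrable_log_measureReal_preimage {f : Ω → β} (hf : Measurable f) :
    Integrable (fun ω => Real.log (μ.real (f ⁻¹' {f ω}))) μ := by
  have : IsProbabilityMeasure (μ.map f) := Measure.isProbabilityMeasure_map hf.aemeasurable
  exact (Integrable.of_finite (μ := μ.map f)
    (f := fun b => Real.log (μ.real (f ⁻¹' {b})))).comp_measurable hf

theorem fentropy_eq_neg_integral {f : Ω → β} (hf : Measurable f) :
    fentropy μ f = -∫ ω, Real.log (μ.real (f ⁻¹' {f ω})) ∂μ := by
  have : IsProbabilityMeasure (μ.map f) := Measure.isProbabilityMeasure_map hf.aemeasurable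
  rw [← integral_map (f := fun b => Real.log (μ.real (f ⁻¹' {b}))) hf.aemeasurable
    (measurable_of_finite _).aestronglyMeasurable, integral_fintype .of_finite,
    ← Finset.sum_neg_distrib]
  refine Finset.sum_congr rfl fun b _ => ?_
  rw [map_measureReal_apply hf (measurableSet_singleton b)]
  simp [Real.negMulLog, Measure.real]

/-- Entropy only depends on the partition generated by the random variable. -/
theorem fentropy_congr {f : Ω → β} {g : Ω → γ} (hf : Measurable f) (hg : Measurable g)
    (h : ∀ ω ω', f ω = f ω' ↔ g ω = g ω') : fentropy μ f = fentropy μ g := by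
  rw [fentropy_eq_neg_integral hf, fentropy_eq_neg_integral hg]
  have (ω : Ω) : f ⁻¹' {f ω} = g ⁻¹' {g ω} := Set.ext fun ω' => h ω' ω
  simp_rw [this]

/-- Submodularity of Shannon entropy. -/
theorem fentropy_submodular {f : Ω → α} {g : Ω → β} {h : Ω → γ} (hf : Measurable f)
    (hg : Measurable g) (hh : Measurable h) :
    fentropy μ (fun ω => (h ω, f ω, g ω)) + fentropy μ h ≤
      fentropy μ (fun ω => (h ω, f ω)) + fentropy μ (fun ω => (h ω, g ω)) := by
  let p : γ → α → β → ℝ := fun c a b => μ.real ((fun ω => (h ω, f ω, g ω)) ⁻¹' {(c, a, b)})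
  have e1 (c a) : μ.real ((fun ω => (h ω, f ω)) ⁻¹' {(c, a)}) = ∑ b, p c a b := by
    rw [measureReal_preimage_eq_sum (hh.prodMk hf) hg]
    refine Finset.sum_congr rfl fun b _ => congrArg μ.real ?_
    ext ω
    simp [and_assoc]
  have e2 (c b) : μ.real ((fun ω => (h ω, g ω)) ⁻¹' {(c, b)}) = ∑ a, p c a b := by
    rw [measureReal_preimage_eq_sum (hh.prodMk hg) hf]
    refine Finset.sum_congr rfl fun a _ => congrArg μ.real ?_
    ext ω
    simp only [Set.mem_preimage, Set.mem_singleton_iff, Prod.mk.injEq]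
    tauto
  have e3 (c) : μ.real (h ⁻¹' {c}) = ∑ a, ∑ b, p c a b := by
    rw [measureReal_preimage_eq_sum hh hf]
    exact Finset.sum_congr rfl fun a _ => e1 c a
  simp only [fentropy, Fintype.sum_prod_type, ← measureReal_def, e1, e2, e3]
  rw [← Finset.sum_add_distrib, ← Finset.sum_add_distrib]
  exact Finset.sum_le_sum fun c _ =>
    sum_negMulLog_add_negMulLog_sum_le (p c) fun _ _ => measureReal_nonneg

end Entropy

section Families

variable {Ω ι : Type*} [MeasurableSpace Ω] {α : ι → Type*} [∀ i, Fintype (α i)]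

/-- The entropy of the tuple `X_S`. -/
noncomputable def jointEntropy [DecidableEq ι] (μ : Measure Ω) (X : ∀ i, Ω → α i)
    (S : Finset ι) : ℝ :=
  fentropy μ (fun ω (j : {j // j ∈ S}) => X j.1 ω)

variable {μ : Measure Ω} [IsProbabilityMeasure μ]
  [∀ i, MeasurableSpace (α i)] [∀ i, MeasurableSingletonClass (α i)]
  {X : ∀ i, Ω → α i}

section DecidableEq

variable [DecidableEq ι]

theorem fmutualInfo_erase_eq (hX : ∀ i, Measurable (X i)) {S : Finset ι} {i : ι} (hi : i ∈ S) :
    fmutualInfo μ (X i) (fun ω (j : {j // j ∈ S.erase i}) => X j.1 ω) =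
      fentropy μ (X i) + jointEntropy μ X (S.erase i) - jointEntropy μ X S := by
  rw [fmutualInfo, jointEntropy, jointEntropy]
  congr 1
  refine fentropy_congr ((hX i).prodMk (measurable_pi_lambda _ fun j => hX j.1))
    (measurable_pi_lambda _ fun j => hX j.1) fun ω ω' => ?_
  simp only [Prod.mk.injEq, funext_iff, Subtype.forall, Finset.mem_erase]
  refine ⟨fun h j hj => ?_, fun h => ⟨h i hi, fun j hj => h j hj.2⟩⟩
  by_cases hji : j = i
  · subst hji; exact h.1
  · exact h.2 j ⟨hji, hj⟩

theorem jointEntropy_add_le (hX : ∀ i, Measurable (X i)) {S T : Finset ι} {i : ι} (hiT : i ∈ T)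
    (hiS : i ∉ S) (hST : S ⊆ T) :
    jointEntropy μ X T + jointEntropy μ X S ≤
      jointEntropy μ X (insert i S) + jointEntropy μ X (T.erase i) := by
  have hm (U : Finset ι) : Measurable (fun ω (j : {j // j ∈ U}) => X j.1 ω) :=
    measurable_pi_lambda _ fun j => hX j.1
  refine le_of_eq_of_le ?_
    ((fentropy_submodular (μ := μ) (hX i) (hm (T.erase i)) (hm S)).trans_eq ?_)
  · congr 1
    refine fentropy_congr (hm T) ((hm S).prodMk ((hX i).prodMk (hm _))) fun ω ω' => ?_
    simp only [Prod.mk.injEq, funext_iff, Subtype.forall, Finset.mem_erase]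
    refine ⟨fun h => ⟨fun j hj => h j (hST hj), h i hiT, fun j hj => h j hj.2⟩,
      fun h j hj => ?_⟩
    by_cases hji : j = i
    · subst hji; exact h.2.1
    · exact h.2.2 j ⟨hji, hj⟩
  · congr 1
    · refine fentropy_congr ((hm S).prodMk (hX i)) (hm _) fun ω ω' => ?_
      simp only [Prod.mk.injEq, funext_iff, Subtype.forall, Finset.mem_insert, forall_eq_or_imp]
      exact and_comm
    · refine fentropy_congr ((hm S).prodMk (hm _)) (hm _) fun ω ω' => ?_
      simp only [Prod.mk.injEq, funext_iff, Subtype.forall, Finset.mem_erase]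
      exact ⟨fun h => h.2,
        fun h => ⟨fun j hj => h j ⟨ne_of_mem_of_not_mem hj hiS, hST hj⟩, h⟩⟩

theorem sum_jointEntropy_sub_erase_le_of_subset (hX : ∀ i, Measurable (X i)) {S T : Finset ι}
    (hST : S ⊆ T) :
    ∑ i ∈ S, (jointEntropy μ X T - jointEntropy μ X (T.erase i)) ≤ jointEntropy μ X S := by
  induction S using Finset.induction_on with
  | empty => exact Finset.sum_empty.trans_le (fentropy_nonneg μ _)
  | insert i S hi ih =>
    rw [Finset.insert_subset_iff] at hST
    rw [Finset.sum_insert hi]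
    linarith [ih hST.2, jointEntropy_add_le (μ := μ) hX hST.1 hi hST.2]

/-- **Han's inequality**, in the form of a lower bound for the potential. -/
theorem sum_fentropy_sub_jointEntropy_le_fphi (hX : ∀ i, Measurable (X i)) (S : Finset ι) :
    ∑ i ∈ S, fentropy μ (X i) - jointEntropy μ X S ≤ fphi μ X S := by
  rw [fphi, Finset.sum_congr rfl fun i hi => fmutualInfo_erase_eq hX hi]
  have h := sum_jointEntropy_sub_erase_le_of_subset (μ := μ) hX (subset_refl S)
  simp only [Finset.sum_sub_distrib, Finset.sum_add_distrib] at h ⊢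
  linarith

theorem jointEntropy_univ [Fintype ι] (hX : ∀ i, Measurable (X i)) :
    jointEntropy μ X Finset.univ = fentropy μ (fun ω i => X i ω) := by
  refine fentropy_congr (measurable_pi_lambda _ fun j => hX j.1)
    (measurable_pi_lambda _ hX) fun ω ω' => ?_
  simp [funext_iff]

end DecidableEq

variable [Fintype ι]

theorem map_pi_absolutelyContinuous_pi_map (hX : ∀ i, Measurable (X i)) :
    Measure.map (fun ω i => X i ω) μ ≪ Measure.pi fun i => Measure.map (X i) μ := by
  have (i : ι) : IsProbabilityMeasure (μ.map (X i)) :=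
    Measure.isProbabilityMeasure_map (hX i).aemeasurable
  intro s hs
  rw [← Set.biUnion_of_singleton s, measure_biUnion_null_iff s.to_countable]
  intro z hz
  have h0 := measure_mono_null (Set.singleton_subset_iff.2 hz) hs
  rw [Measure.pi_singleton, Finset.prod_eq_zero_iff] at h0
  obtain ⟨i, -, hi⟩ := h0
  rw [Measure.map_apply (hX i) (measurableSet_singleton _)] at hi
  rw [Measure.map_apply (measurable_pi_lambda _ hX) (measurableSet_singleton _)]
  exact measure_mono_null (fun ω hω => congrFun hω i) hi

theorem klDivR_map_pi_eq [DecidableEq ι] (hX : ∀ i, Measurable (X i)) :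
    klDivR (Measure.map (fun ω i => X i ω) μ) (Measure.pi fun i => Measure.map (X i) μ) =
      ∑ i, fentropy μ (X i) - fentropy μ (fun ω i => X i ω) := by
  have hXm : Measurable (fun ω i => X i ω) := measurable_pi_lambda _ hX
  have (i : ι) : IsProbabilityMeasure (μ.map (X i)) :=
    Measure.isProbabilityMeasure_map (hX i).aemeasurable
  have : IsProbabilityMeasure (μ.map fun ω i => X i ω) :=
    Measure.isProbabilityMeasure_map hXm.aemeasurable
  have hlog (z : ∀ i, α i) (hz : μ.real ((fun ω i => X i ω) ⁻¹' {z}) ≠ 0) :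
      Real.log ((Measure.map (fun ω i => X i ω) μ).rnDeriv
          (Measure.pi fun i => Measure.map (X i) μ) z).toReal =
        Real.log (μ.real ((fun ω i => X i ω) ⁻¹' {z})) -
          ∑ i, Real.log (μ.real (X i ⁻¹' {z i})) := by
    have h1 := Measure.setLIntegral_rnDeriv (map_pi_absolutelyContinuous_pi_map (μ := μ) hX) {z}
    rw [lintegral_singleton, Measure.pi_singleton,
      Measure.map_apply hXm (measurableSet_singleton _)] at h1
    have h2 := congrArg ENNReal.toReal h1
    simp only [Measure.map_apply (hX _) (measurableSet_singleton _), ENNReal.toReal_mul,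
      ENNReal.toReal_prod, ← measureReal_def] at h2
    have h3 := hz
    rw [← h2] at h3
    rw [← h2, Real.log_mul (left_ne_zero_of_mul h3) (right_ne_zero_of_mul h3),
      Real.log_prod fun i hi => Finset.prod_ne_zero_iff.1 (right_ne_zero_of_mul h3) i hi]
    ring
  rw [klDivR, integral_fintype .of_finite]
  have hsum : ∀ z : ∀ i, α i, (Measure.map (fun ω i => X i ω) μ).real {z} •
      Real.log ((Measure.map (fun ω i => X i ω) μ).rnDeriv
          (Measure.pi fun i => Measure.map (X i) μ) z).toReal =
      (Measure.map (fun ω i => X i ω) μ).real {z} •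
        (Real.log (μ.real ((fun ω i => X i ω) ⁻¹' {z})) -
          ∑ i, Real.log (μ.real (X i ⁻¹' {z i}))) := by
    intro z
    rw [map_measureReal_apply hXm (measurableSet_singleton _)]
    by_cases hz : μ.real ((fun ω i => X i ω) ⁻¹' {z}) = 0
    · rw [hz, zero_smul, zero_smul]
    · rw [hlog z hz]
  rw [Finset.sum_congr rfl fun z _ => hsum z, ← integral_fintype .of_finite,
    integral_map hXm.aemeasurable (measurable_of_finite _).aestronglyMeasurable,
    integral_sub (integrable_log_measureReal_preimage hXm)
      (integrable_finsetSum _ fun i _ => integrable_log_measureReal_preimage (hX i)),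
    integral_finsetSum _ fun i _ => integrable_log_measureReal_preimage (hX i),
    fentropy_eq_neg_integral hXm,
    Finset.sum_congr rfl fun i _ => fentropy_eq_neg_integral (hX i), Finset.sum_neg_distrib]
  ring

end Families

/-- The total correlation
`D(law(X_1,…,X_n) ‖ law(X_1) ⊗ ⋯ ⊗ law(X_n))` is at most the potential `φ(X_{[n]})`. -/
theorem total_correlation_le_potential {Ω : Type*} [MeasurableSpace Ω] (μ : Measure Ω)
    [IsProbabilityMeasure μ] {n : ℕ} (hn : 2 ≤ n)
    (α : Fin n → Type*) [∀ i, Fintype (α i)]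
    [∀ i, MeasurableSpace (α i)] [∀ i, MeasurableSingletonClass (α i)]
    (X : ∀ i, Ω → α i) (hX : ∀ i, Measurable (X i)) :
    klDivR (Measure.map (fun ω (i : Fin n) => X i ω) μ)
        (Measure.pi (fun i : Fin n => Measure.map (X i) μ)) ≤
      fphi μ X (Finset.univ : Finset (Fin n)) := by
  rw [klDivR_map_pi_eq hX, ← jointEntropy_univ hX]
  exact sum_fentropy_sub_jointEntropy_le_fphi hX Finset.univ
end

section
/- Let μ and ν be mutually absolutely continuous probability measures on the same measurable space. Then for every measurable set E, ∫_E min{1, (dμ/dν)(x)} dν(x) + ∫_E max{0, 1 − (dν/dμ)(x)} dμ(x) = μ(E). (This is the correctness of speculative rejection sampling: the mixture of the accepted-speculation distribution, occurring with probability 1 − dTV(μ,ν), and the accepted-fallback distribution, occurring with probability dTV(μ,ν), is exactly μ.) -/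
open MeasureTheory

/-- Total variation distance `dTV(μ, ν) = sup_E |μ(E) - ν(E)|` over measurable sets `E`. -/
noncomputable def tvDist {Ω : Type*} [MeasurableSpace Ω] (μ ν : Measure Ω) : ℝ :=
  ⨆ s : {s : Set Ω // MeasurableSet s}, |(μ s.1).toReal - (ν s.1).toReal|

theorem min_one_add_mul_max_zero_one_sub_inv {r : ℝ} (hr : 0 < r) :
    min 1 r + r * max 0 (1 - r⁻¹) = r := by
  rw [mul_max_of_nonneg _ _ hr.le, mul_sub, mul_inv_cancel₀ hr.ne']
  rcases le_total 1 r with h | h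
  · rw [min_eq_left h, max_eq_right (by linarith)]; ring
  · rw [min_eq_right h, max_eq_left (by linarith)]; ring

/-- correctness of speculative rejection sampling.
If `μ` and `ν` are mutually absolutely continuous probability measures, then for every
measurable set `E`,
`∫_E min{1, dμ/dν} dν + ∫_E max{0, 1 - dν/dμ} dμ = μ(E)`. -/
theorem speculative_rejection_sampling_correct {Ω : Type*} [MeasurableSpace Ω]
    (μ ν : Measure Ω) [IsProbabilityMeasure μ] [IsProbabilityMeasure ν]
    (hμν : μ ≪ ν) (hνμ : ν ≪ μ) (E : Set Ω) (hE : MeasurableSet E) :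
    (∫ x in E, min 1 ((μ.rnDeriv ν x).toReal) ∂ν) +
      (∫ x in E, max 0 (1 - (ν.rnDeriv μ x).toReal) ∂μ) = (μ E).toReal := by
  have hr : Integrable (fun x => (μ.rnDeriv ν x).toReal) (ν.restrict E) :=
    Measure.integrable_toReal_rnDeriv.restrict
  have hmin : Integrable (fun x => min 1 (μ.rnDeriv ν x).toReal) (ν.restrict E) :=
    (integrable_const (1 : ℝ)).inf hr
  have key : ∀ᵐ x ∂ν.restrict E, min 1 (μ.rnDeriv ν x).toReal +
      (μ.rnDeriv ν x).toReal * max 0 (1 - (ν.rnDeriv μ x).toReal) = (μ.rnDeriv ν x).toReal := by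
    refine ae_restrict_of_ae ?_
    filter_upwards [Measure.inv_rnDeriv' hνμ, Measure.rnDeriv_pos' hνμ,
      Measure.rnDeriv_lt_top μ ν] with x hinv hpos htop
    rw [← hinv, Pi.inv_apply, ENNReal.toReal_inv]
    exact min_one_add_mul_max_zero_one_sub_inv (ENNReal.toReal_pos hpos.ne' htop.ne)
  have hmul : Integrable (fun x => (μ.rnDeriv ν x).toReal *
      max 0 (1 - (ν.rnDeriv μ x).toReal)) (ν.restrict E) :=
    (hr.sub hmin).congr (key.mono fun x hx => (eq_sub_of_add_eq' hx).symm)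
  rw [← setIntegral_toReal_rnDeriv_mul hμν hE, ← integral_add hmin hmul, integral_congr_ae key]
  exact Measure.setIntegral_toReal_rnDeriv hμν E
end

section
/- Let N ≥ 1 and let D_1, …, D_N be random variables taking values in [0,1], defined on a common probability space. Define φ̃ : [0,1] → ℝ by φ̃(x) = x·log(1/x) for x > 0 and φ̃(0) = 0 (natural logarithm). Then E[ Σ_{i=1}^N φ̃(D_i) ] ≤ (log N + 1) · E[ Σ_{i=1}^N D_i ] + 1/e. -/
open MeasureTheory

/-- The tangent line bound for `Real.negMulLog` at the point `1 / (e a)`. -/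
theorem Real.negMulLog_le_log_mul_add {a x : ℝ} (ha : 0 < a) (hx : 0 ≤ x) :
    Real.negMulLog x ≤ Real.log a * x + (a * Real.exp 1)⁻¹ := by
  have hpos : 0 < a * Real.exp 1 := by positivity
  have hlog : Real.log (a * Real.exp 1) = Real.log a + 1 := by
    rw [Real.log_mul ha.ne' (Real.exp_pos 1).ne', Real.log_exp]
  have h := Real.negMulLog_le_one_sub_self (mul_nonneg hx hpos.le)
  rw [Real.negMulLog_mul, Real.negMulLog_def] at h
  simp only [hlog] at h
  refine le_of_mul_le_mul_left ?_ hpos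
  rw [mul_add, mul_inv_cancel₀ hpos.ne', Real.negMulLog_def]
  linarith

/-- For `[0,1]`-valued random variables `D_1, …, D_N` and
`φ̃(x) = x log(1/x)` (with `φ̃(0) = 0`, i.e. `φ̃ = Real.negMulLog` on `[0,1]`),
`E[∑ i φ̃(D_i)] ≤ (log N + 1) · E[∑ i D_i] + 1/e`. -/
theorem expected_negMulLog_sum_bound {Ω : Type*} [MeasurableSpace Ω] (μ : Measure Ω)
    [IsProbabilityMeasure μ] {N : ℕ} (hN : 1 ≤ N)
    (D : Fin N → Ω → ℝ) (hmeas : ∀ i, Measurable (D i))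
    (hrange : ∀ i ω, D i ω ∈ Set.Icc (0 : ℝ) 1) :
    ∫ ω, (∑ i : Fin N, Real.negMulLog (D i ω)) ∂μ ≤
      (Real.log N + 1) * ∫ ω, (∑ i : Fin N, D i ω) ∂μ + (Real.exp 1)⁻¹ := by
  have hN' : (0 : ℝ) < N := by exact_mod_cast hN
  have hint : ∀ i, Integrable (D i) μ := fun i =>
    .of_bound (hmeas i).aestronglyMeasurable 1 <| .of_forall fun ω => by
      rw [Real.norm_of_nonneg (hrange i ω).1]
      exact (hrange i ω).2
  have hsum : Integrable (fun ω => ∑ i, D i ω) μ := integrable_finsetSum _ fun i _ => hint i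
  rw [← integral_const_mul]
  calc
    _ ≤ ∫ ω, ((Real.log N + 1) * ∑ i, D i ω + (Real.exp 1)⁻¹) ∂μ := by
      refine integral_mono_of_nonneg (.of_forall fun ω => ?_)
        ((hsum.const_mul _).add (integrable_const _)) (.of_forall fun ω => ?_)
      · exact Finset.sum_nonneg fun i _ =>
          Real.negMulLog_nonneg (hrange i ω).1 (hrange i ω).2
      · have hD : 0 ≤ ∑ i, D i ω := Finset.sum_nonneg fun i _ => (hrange i ω).1
        calc
          _ ≤ ∑ i, (Real.log N * D i ω + (N * Real.exp 1)⁻¹) :=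
            Finset.sum_le_sum fun i _ => Real.negMulLog_le_log_mul_add hN' (hrange i ω).1
          _ = Real.log N * ∑ i, D i ω + (Real.exp 1)⁻¹ := by
            rw [Finset.sum_add_distrib, ← Finset.mul_sum]
            simp [hN'.ne', mul_comm]
          _ ≤ (Real.log N + 1) * ∑ i, D i ω + (Real.exp 1)⁻¹ := by linarith
    _ = _ := by
      rw [integral_add (hsum.const_mul _) (integrable_const _)]
      simp
end

section
/- Let q ≥ 1 and let π be a probability distribution on [q]^n. Let k ≥ 1 divide n, set ñ = n/k, and for r ∈ [k] let S_r = {ñ(r−1)+1, …, ñr}. Let σ be a uniformly random permutation of [n] and let X ~ π. For each r, let μ_r be the conditional joint law of (X_{σ(i)})_{i∈S_r} given the values (X_{σ(i)})_{i∈S_1∪⋯∪S_{r−1}}, and let ν_r be the product, over i ∈ S_r, of the conditional marginal laws of X_{σ(i)} given the same values. Then E_σ[ E_{X~π}[ Σ_{r=1}^k dTV(μ_r, ν_r) ] ] ≤ √(n·log q), where the inner expectation averages over the realized conditioning values. -/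
open MeasureTheory ProbabilityTheory

section FiniteSums

variable {Ω α β γ : Type*} [Fintype Ω] {p : Ω → ℝ}

lemma sum_mul_log_nonpos (hp : ∀ ω, 0 ≤ p ω) (hs : ∑ ω, p ω = 1) {R : Ω → ℝ}
    (hR : ∀ ω, 0 < p ω → 0 < R ω) (h : ∑ ω, p ω * R ω ≤ 1) :
    ∑ ω, p ω * Real.log (R ω) ≤ 0 := by
  have key : ∑ ω, p ω * Real.log (R ω) ≤ ∑ ω, (p ω * R ω - p ω) := by
    refine Finset.sum_le_sum fun ω _ => ?_
    rcases (hp ω).eq_or_lt with h0 | h0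
    · simp [← h0]
    · have := Real.log_le_sub_one_of_pos (hR ω h0)
      nlinarith
  rw [Finset.sum_sub_distrib, hs] at key
  linarith

open Classical in
/-- The law of `X` at the point `x` when `Ω` carries the weights `p`. -/
noncomputable def marginal (p : Ω → ℝ) (X : Ω → α) (x : α) : ℝ :=
  ∑ ω, if X ω = x then p ω else 0

lemma marginal_nonneg (hp : ∀ ω, 0 ≤ p ω) (X : Ω → α) (x : α) : 0 ≤ marginal p X x := by
  classical
  exact Finset.sum_nonneg fun ω _ => by split_ifs <;> simp [hp ω]

lemma sum_marginal_mul [Fintype α] (X : Ω → α) (K : α → ℝ) :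
    ∑ x, marginal p X x * K x = ∑ ω, p ω * K (X ω) := by
  classical
  simp only [marginal, Finset.sum_mul]
  rw [Finset.sum_comm]
  simp [ite_mul]

lemma sum_marginal_prodMk [Fintype α] (X : Ω → α) (Y : Ω → β) (y : β) :
    ∑ x, marginal p (fun ω => (X ω, Y ω)) (x, y) = marginal p Y y := by
  classical
  simp only [marginal, Prod.mk.injEq, ite_and]
  rw [Finset.sum_comm]
  simp

lemma sum_mul_marginal_ratio_le_one [Fintype α] [Fintype β] [Fintype γ]
    (hp : ∀ ω, 0 ≤ p ω) (hs : ∑ ω, p ω = 1) (a : Ω → α) (b : Ω → β) (c : Ω → γ) :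
    ∑ ω, p ω * (marginal p (fun ω => (a ω, c ω)) (a ω, c ω) *
      marginal p (fun ω => (b ω, c ω)) (b ω, c ω) /
      (marginal p (fun ω => (a ω, b ω, c ω)) (a ω, b ω, c ω) * marginal p c (c ω))) ≤ 1 := by
  rw [← sum_marginal_mul (fun ω => (a ω, b ω, c ω)) (fun x =>
    marginal p (fun ω => (a ω, c ω)) (x.1, x.2.2) *
      marginal p (fun ω => (b ω, c ω)) (x.2.1, x.2.2) /
      (marginal p (fun ω => (a ω, b ω, c ω)) x * marginal p c x.2.2))]
  calc _ ≤ ∑ x : α × β × γ, marginal p (fun ω => (a ω, c ω)) (x.1, x.2.2) *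
      marginal p (fun ω => (b ω, c ω)) (x.2.1, x.2.2) / marginal p c x.2.2 := by
        refine Finset.sum_le_sum fun x _ => ?_
        have h1 := marginal_nonneg hp (fun ω => (a ω, c ω)) (x.1, x.2.2)
        have h2 := marginal_nonneg hp (fun ω => (b ω, c ω)) (x.2.1, x.2.2)
        have h3 := marginal_nonneg hp c x.2.2
        rcases (marginal_nonneg hp (fun ω => (a ω, b ω, c ω)) x).eq_or_lt with h0 | h0
        · rw [← h0, zero_mul]; positivity
        · rw [mul_div_assoc', mul_div_mul_left _ _ h0.ne']
    _ = ∑ z, marginal p c z := by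
        rw [Fintype.sum_prod_type, Finset.sum_congr rfl fun x _ => Fintype.sum_prod_type _]
        simp only
        rw [Finset.sum_congr rfl fun x _ => Finset.sum_comm, Finset.sum_comm]
        refine Finset.sum_congr rfl fun z _ => ?_
        simp only [← Finset.sum_div, ← Finset.mul_sum, ← Finset.sum_mul, sum_marginal_prodMk]
        rw [mul_self_div_self]
    _ = 1 := by simpa [hs] using sum_marginal_mul (p := p) c (fun _ => 1)
    _ ≤ 1 := le_rfl

end FiniteSums

section TotalVariation

lemma sum_ite_measureReal_singleton {Ω : Type*} [Fintype Ω] [MeasurableSpace Ω]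
    [MeasurableSingletonClass Ω] (ρ : Measure Ω) [IsFiniteMeasure ρ] (s : Set Ω)
    [DecidablePred (· ∈ s)] :
    ∑ ω, (if ω ∈ s then ρ.real {ω} else 0) = ρ.real s := by
  have h := sum_measureReal_singleton (μ := ρ) (Finset.univ.filter (· ∈ s))
  rw [Finset.sum_filter] at h
  rw [h]
  simp

lemma tvDist_nonneg {Ω : Type*} [MeasurableSpace Ω] (μ ν : Measure Ω) : 0 ≤ tvDist μ ν :=
  Real.iSup_nonneg fun _ => abs_nonneg _

/-- A form of Pinsker's inequality, with constant `1`, on a finite discrete space. -/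
lemma tvDist_sq_le_sum_mul_log {Ω : Type*} [MeasurableSpace Ω] [Fintype Ω]
    [MeasurableSingletonClass Ω] (μ ν : Measure Ω) [IsProbabilityMeasure μ]
    [IsProbabilityMeasure ν] (hμν : ∀ ω, 0 < μ.real {ω} → 0 < ν.real {ω}) :
    tvDist μ ν ^ 2 ≤ ∑ ω, μ.real {ω} * Real.log (μ.real {ω} / ν.real {ω}) := by
  classical
  set a : Ω → ℝ := fun ω => μ.real {ω} with ha
  set b : Ω → ℝ := fun ω => ν.real {ω} with hb
  have ha0 : ∀ ω, 0 ≤ a ω := fun ω => measureReal_nonneg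
  have hb0 : ∀ ω, 0 ≤ b ω := fun ω => measureReal_nonneg
  have ha1 : ∑ ω, a ω = 1 := by simp [ha]
  have hb1 : ∑ ω, b ω = 1 := by simp [hb]
  have h1 : tvDist μ ν ≤ (∑ ω, |a ω - b ω|) / 2 := by
    refine ciSup_le fun ⟨s, _⟩ => ?_
    have h2 : (μ s).toReal - (ν s).toReal =
        (∑ ω, (if ω ∈ s then 1 else -1) * (a ω - b ω)) / 2 := by
      rw [← measureReal_def, ← measureReal_def, ← sum_ite_measureReal_singleton,
        ← sum_ite_measureReal_singleton, ← Finset.sum_sub_distrib]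
      have : ∑ ω, (a ω - b ω) = 0 := by rw [Finset.sum_sub_distrib, ha1, hb1, sub_self]
      rw [eq_div_iff two_ne_zero, Finset.sum_mul,
        ← add_zero (∑ ω, (if ω ∈ s then (1 : ℝ) else -1) * _), ← this, ← Finset.sum_add_distrib]
      refine Finset.sum_congr rfl fun ω _ => ?_
      by_cases h : ω ∈ s <;> simp [h, ha, hb]
      ring
    rw [h2, abs_div, abs_two]
    gcongr
    refine (Finset.abs_sum_le_sum_abs _ _).trans_eq (Finset.sum_congr rfl fun ω _ => ?_)
    split_ifs <;> simp [abs_sub_comm]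
  have hfac : ∀ ω, |a ω - b ω| = |√(a ω) - √(b ω)| * (√(a ω) + √(b ω)) := by
    intro ω
    rw [← abs_of_nonneg (add_nonneg (Real.sqrt_nonneg (a ω)) (Real.sqrt_nonneg (b ω))), ← abs_mul]
    congr 1
    nlinarith [Real.sq_sqrt (ha0 ω), Real.sq_sqrt (hb0 ω)]
  have hcs := Finset.sum_mul_sq_le_sq_mul_sq Finset.univ (fun ω => |√(a ω) - √(b ω)|)
    (fun ω => √(a ω) + √(b ω))
  simp only [← hfac, sq_abs] at hcs
  have h4 : ∑ ω, (√(a ω) + √(b ω)) ^ 2 ≤ 4 := by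
    calc _ ≤ ∑ ω, (2 * a ω + 2 * b ω) := Finset.sum_le_sum fun ω _ => by
          nlinarith [Real.sq_sqrt (ha0 ω), Real.sq_sqrt (hb0 ω), sq_nonneg (√(a ω) - √(b ω))]
      _ = 4 := by rw [Finset.sum_add_distrib, ← Finset.mul_sum, ← Finset.mul_sum, ha1, hb1]; norm_num
  have h5 : ∑ ω, (√(a ω) - √(b ω)) ^ 2 ≤ ∑ ω, a ω * Real.log (a ω / b ω) := by
    calc _ = ∑ ω, (2 * (a ω - √(a ω) * √(b ω)) + (b ω - a ω)) :=
          Finset.sum_congr rfl fun ω _ => by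
            nlinarith [Real.sq_sqrt (ha0 ω), Real.sq_sqrt (hb0 ω)]
      _ = ∑ ω, 2 * (a ω - √(a ω) * √(b ω)) := by
          rw [Finset.sum_add_distrib, Finset.sum_sub_distrib _ _, ha1, hb1, sub_self, add_zero]
      _ ≤ _ := Finset.sum_le_sum fun ω _ => by
          rcases (ha0 ω).eq_or_lt with h0 | h0
          · simp [← h0]
          · have hbp : 0 < b ω := hμν ω h0
            have hsa := Real.sqrt_pos.2 h0
            have hsb := Real.sqrt_pos.2 hbp
            have hl := Real.log_le_sub_one_of_pos (div_pos hsb hsa)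
            rw [Real.log_div hsb.ne' hsa.ne', Real.log_sqrt h0.le, Real.log_sqrt hbp.le] at hl
            rw [Real.log_div h0.ne' hbp.ne']
            have : a ω * (√(b ω) / √(a ω)) = √(a ω) * √(b ω) := by
              field_simp
              rw [Real.sq_sqrt h0.le]
            nlinarith
  have h6 : 0 ≤ ∑ ω, (√(a ω) - √(b ω)) ^ 2 := Finset.sum_nonneg fun ω _ => sq_nonneg _
  calc tvDist μ ν ^ 2 ≤ ((∑ ω, |a ω - b ω|) / 2) ^ 2 :=
        pow_le_pow_left₀ (tvDist_nonneg μ ν) h1 2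
    _ ≤ _ := by nlinarith

end TotalVariation

section CoordinateEntropy

variable {ι κ : Type*}

/-- The configurations agreeing with `z` on the coordinates in `A`. -/
def agreeOn (A : Finset ι) (z : ι → κ) : Set (ι → κ) := {y | ∀ i ∈ A, y i = z i}

lemma self_mem_agreeOn (A : Finset ι) (z : ι → κ) : z ∈ agreeOn A z := fun _ _ => rfl

lemma agreeOn_eq_of_mem {A : Finset ι} {y z : ι → κ} (h : y ∈ agreeOn A z) :
    agreeOn A z = agreeOn A y := by
  ext w
  exact forall₂_congr fun i hi => by rw [h i hi]

lemma measureReal_agreeOn_pos [MeasurableSpace κ] {π : Measure (ι → κ)}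
    [IsProbabilityMeasure π] {z : ι → κ} (hz : 0 < π.real {z}) (A : Finset ι) :
    0 < π.real (agreeOn A z) :=
  hz.trans_le (measureReal_mono (Set.singleton_subset_iff.2 (self_mem_agreeOn A z)))

lemma marginal_measureReal {Ω α : Type*} [Fintype Ω] [MeasurableSpace Ω]
    [MeasurableSingletonClass Ω] (ρ : Measure Ω) [IsFiniteMeasure ρ] (X : Ω → α) (x : α) :
    marginal (fun ω => ρ.real {ω}) X x = ρ.real {ω | X ω = x} := by
  classical
  rw [marginal, ← sum_ite_measureReal_singleton]
  simp only [Set.mem_ofPred_eq]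

variable [Fintype ι] [Fintype κ] [DecidableEq ι] [MeasurableSpace κ]

/-- The Shannon entropy, in nats, of the coordinates in `A` of a `π`-random configuration. -/
noncomputable def coordEntropy (π : Measure (ι → κ)) (A : Finset ι) : ℝ :=
  -∑ z, π.real {z} * Real.log (π.real (agreeOn A z))

variable (π : Measure (ι → κ)) [IsProbabilityMeasure π]

lemma coordEntropy_mono {A B : Finset ι} (h : A ⊆ B) : coordEntropy π A ≤ coordEntropy π B := by
  simp only [coordEntropy]
  refine neg_le_neg (Finset.sum_le_sum fun z _ => ?_)
  rcases (measureReal_nonneg (μ := π) (s := {z})).eq_or_lt with h0 | h0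
  · simp [← h0]
  · have : π.real (agreeOn B z) ≤ π.real (agreeOn A z) :=
      measureReal_mono fun y hy i hi => hy i (h hi)
    gcongr
    exact measureReal_agreeOn_pos h0 B

lemma coordEntropy_empty : coordEntropy π ∅ = 0 := by
  simp [coordEntropy, agreeOn]

variable [MeasurableSingletonClass κ]

lemma sum_measureReal_singleton_univ : ∑ z, π.real {z} = 1 := by
  simp

lemma coordEntropy_submodular (A : Finset ι) (i j : ι) :
    coordEntropy π (insert i (insert j A)) + coordEntropy π A ≤
      coordEntropy π (insert i A) + coordEntropy π (insert j A) := by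
  have h := sum_mul_marginal_ratio_le_one (p := fun z => π.real {z})
    (fun _ => measureReal_nonneg) (sum_measureReal_singleton_univ π)
    (fun z : ι → κ => z i) (fun z => z j) (fun z => A.restrict z)
  have hc : ∀ z, marginal (fun z => π.real {z}) (fun z : ι → κ => A.restrict z) (A.restrict z) =
      π.real (agreeOn A z) := fun z => by
    rw [marginal_measureReal]
    simp [agreeOn, funext_iff]
  have hone : ∀ l z, marginal (fun z => π.real {z}) (fun z : ι → κ => (z l, A.restrict z))
      (z l, A.restrict z) = π.real (agreeOn (insert l A) z) := fun l z => by
    rw [marginal_measureReal]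
    simp [agreeOn, funext_iff]
  have htwo : ∀ z, marginal (fun z => π.real {z}) (fun z : ι → κ => (z i, z j, A.restrict z))
      (z i, z j, A.restrict z) = π.real (agreeOn (insert i (insert j A)) z) := fun z => by
    rw [marginal_measureReal]
    simp [agreeOn, funext_iff]
  simp only [hc, hone, htwo] at h
  have key := sum_mul_log_nonpos (fun _ => measureReal_nonneg)
    (sum_measureReal_singleton_univ π) (fun z hz => by
      have := measureReal_agreeOn_pos hz
      exact div_pos (mul_pos (this _) (this _)) (mul_pos (this _) (this _))) h
  simp only [coordEntropy]
  have : ∑ z, π.real {z} * Real.log (π.real (agreeOn (insert i A) z) *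
        π.real (agreeOn (insert j A) z) / (π.real (agreeOn (insert i (insert j A)) z) *
        π.real (agreeOn A z))) =
      ∑ z, π.real {z} * Real.log (π.real (agreeOn (insert i A) z)) +
      ∑ z, π.real {z} * Real.log (π.real (agreeOn (insert j A) z)) -
      ∑ z, π.real {z} * Real.log (π.real (agreeOn (insert i (insert j A)) z)) -
      ∑ z, π.real {z} * Real.log (π.real (agreeOn A z)) := by
    rw [← Finset.sum_add_distrib, ← Finset.sum_sub_distrib, ← Finset.sum_sub_distrib]
    refine Finset.sum_congr rfl fun z _ => ?_
    rcases (measureReal_nonneg (μ := π) (s := {z})).eq_or_lt with h0 | h0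
    · simp [← h0]
    · have := fun B => (measureReal_agreeOn_pos h0 B).ne'
      rw [Real.log_div (mul_ne_zero (this _) (this _)) (mul_ne_zero (this _) (this _)),
        Real.log_mul (this _) (this _), Real.log_mul (this _) (this _)]
      ring
  linarith

lemma coordEntropy_singleton_le (i : ι) : coordEntropy π {i} ≤ Real.log (Fintype.card κ) := by
  have hpos : ∀ z : ι → κ, 0 < (Fintype.card κ : ℝ) := fun z =>
    Nat.cast_pos.2 (Fintype.card_pos_iff.2 ⟨z i⟩)
  have hm : ∀ z, π.real (agreeOn {i} z) =
      marginal (fun z => π.real {z}) (fun z : ι → κ => z i) (z i) := fun z => by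
    rw [marginal_measureReal]
    simp [agreeOn]
  have h : ∑ z, π.real {z} * (1 / (Fintype.card κ * π.real (agreeOn {i} z))) ≤ 1 := by
    simp only [hm]
    rw [← sum_marginal_mul (p := fun z => π.real {z}) (fun z : ι → κ => z i)
      (fun x => 1 / (Fintype.card κ * marginal (fun z => π.real {z}) (fun z => z i) x))]
    calc _ ≤ ∑ _x : κ, (1 : ℝ) / Fintype.card κ := Finset.sum_le_sum fun x _ => by
          rcases (marginal_nonneg (p := fun z => π.real {z}) (fun _ => measureReal_nonneg)
            (fun z : ι → κ => z i) x).eq_or_lt with h0 | h0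
          · rw [← h0, zero_mul]; positivity
          · rw [mul_one_div, mul_comm (Fintype.card κ : ℝ), ← div_div, div_self h0.ne']
      _ ≤ 1 := by
          simp only [Finset.sum_const, Finset.card_univ, nsmul_eq_mul, mul_one_div]
          exact div_self_le_one _
  have key := sum_mul_log_nonpos (fun _ => measureReal_nonneg)
    (sum_measureReal_singleton_univ π) (fun z hz => by
      have := measureReal_agreeOn_pos hz {i}
      have := hpos z
      positivity) h
  have : ∑ z, π.real {z} * Real.log (1 / (Fintype.card κ * π.real (agreeOn {i} z))) =
      ∑ z, (-(π.real {z} * Real.log (π.real (agreeOn {i} z))) -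
        π.real {z} * Real.log (Fintype.card κ)) := by
    refine Finset.sum_congr rfl fun z _ => ?_
    rcases (measureReal_nonneg (μ := π) (s := {z})).eq_or_lt with h0 | h0
    · simp [← h0]
    · rw [one_div, Real.log_inv, Real.log_mul (hpos z).ne' (measureReal_agreeOn_pos h0 _).ne']
      ring
  rw [this, Finset.sum_sub_distrib, Finset.sum_neg_distrib, ← Finset.sum_mul,
    sum_measureReal_singleton_univ, one_mul] at key
  rw [coordEntropy]
  linarith

lemma cond_real_apply {Ω : Type*} [MeasurableSpace Ω] (ρ : Measure Ω) {s : Set Ω}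
    (hs : MeasurableSet s) (t : Set Ω) : (ρ[|s]).real t = ρ.real (s ∩ t) / ρ.real s := by
  simp [measureReal_def, cond_apply hs, ENNReal.toReal_mul, ENNReal.toReal_inv, div_eq_inv_mul]

/-- The squared distance between the conditional joint law of the coordinates `e j` given those
in `A` and the product of the conditional marginals is at most the relative entropy. -/
lemma tvDist_cond_sq_le {J : Type*} [Fintype J] [DecidableEq J] (A : Finset ι) (e : J → ι)
    {z : ι → κ} (hz : 0 < π.real {z}) [DecidablePred (· ∈ agreeOn A z)] :
    tvDist (Measure.map (fun y j => y (e j)) (π[|agreeOn A z]))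
      (Measure.pi fun j => Measure.map (fun y => y (e j)) (π[|agreeOn A z])) ^ 2 ≤
    ∑ y, (if y ∈ agreeOn A z then π.real {y} / π.real (agreeOn A z) else 0) *
      (Real.log (π.real (agreeOn (A ∪ Finset.univ.image e) y)) - Real.log (π.real (agreeOn A y)) -
        ∑ j, (Real.log (π.real (agreeOn (insert (e j) A) y)) -
          Real.log (π.real (agreeOn A y)))) := by
  classical
  have hms : ∀ B, MeasurableSet (agreeOn B z) := fun B => (Set.toFinite _).measurableSet
  have hA := measureReal_agreeOn_pos hz A
  have : IsProbabilityMeasure (π[|agreeOn A z]) :=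
    cond_isProbabilityMeasure fun h => hA.ne' (by simp [measureReal_def, h])
  set ρ := π[|agreeOn A z] with hρ
  have hmW : Measurable fun (y : ι → κ) (j : J) => y (e j) := by fun_prop
  have hmj : ∀ j, Measurable fun y : ι → κ => y (e j) := fun j => by fun_prop
  have : IsProbabilityMeasure (Measure.map (fun y j => y (e j)) ρ) :=
    Measure.isProbabilityMeasure_map hmW.aemeasurable
  have : ∀ j, IsProbabilityMeasure (Measure.map (fun y => y (e j)) ρ) := fun j =>
    Measure.isProbabilityMeasure_map (hmj j).aemeasurable
  have hμ : ∀ w, (Measure.map (fun y j => y (e j)) ρ).real {w} =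
      ρ.real {y | (fun j => y (e j)) = w} := fun w =>
    map_measureReal_apply hmW (measurableSet_singleton w)
  have hν : ∀ w, (Measure.pi fun j => Measure.map (fun y => y (e j)) ρ).real {w} =
      ∏ j, ρ.real {y | y (e j) = w j} := fun w => by
    rw [measureReal_def, Measure.pi_singleton, ENNReal.toReal_prod]
    refine Finset.prod_congr rfl fun j _ => ?_
    exact map_measureReal_apply (hmj j) (measurableSet_singleton _)
  refine (tvDist_sq_le_sum_mul_log _ _ fun w hw => ?_).trans_eq ?_
  · rw [hν]
    rw [hμ] at hw
    exact Finset.prod_pos fun j _ => hw.trans_le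
      (measureReal_mono fun y hy => congrFun hy j)
  · have hm : ∀ w, (Measure.map (fun y j => y (e j)) ρ).real {w} =
        marginal (fun y => ρ.real {y}) (fun y j => y (e j)) w := fun w => by
      rw [hμ, marginal_measureReal]
    have hs := sum_marginal_mul (p := fun y => ρ.real {y}) (fun y j => y (e j)) fun w =>
      Real.log ((Measure.map (fun y j => y (e j)) ρ).real {w} /
        (Measure.pi fun j => Measure.map (fun y => y (e j)) ρ).real {w})
    simp only [← hm] at hs
    rw [hs]
    refine Finset.sum_congr rfl fun y _ => ?_
    have hρy : ρ.real {y} =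
        if y ∈ agreeOn A z then π.real {y} / π.real (agreeOn A z) else 0 := by
      rw [hρ, cond_real_apply _ (hms A)]
      split_ifs with h
      · rw [Set.inter_eq_right.2 (Set.singleton_subset_iff.2 h)]
      · rw [Set.inter_singleton_eq_empty.2 h]; simp
    rw [hρy]
    split_ifs with h
    swap
    · simp
    rcases (measureReal_nonneg (μ := π) (s := {y})).eq_or_lt with h0 | h0
    · simp [← h0]
    congr 1
    have hp := fun B => (measureReal_agreeOn_pos h0 B).ne'
    have h1 : ρ.real {y' | (fun j => y' (e j)) = fun j => y (e j)} =
        π.real (agreeOn (A ∪ Finset.univ.image e) y) / π.real (agreeOn A y) := by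
      rw [hρ, cond_real_apply _ (hms A), agreeOn_eq_of_mem h]
      congr 2
      ext w
      simp [agreeOn, funext_iff, or_imp, forall_and]
    have h2 : ∀ j, ρ.real {y' | y' (e j) = y (e j)} =
        π.real (agreeOn (insert (e j) A) y) / π.real (agreeOn A y) := fun j => by
      rw [hρ, cond_real_apply _ (hms A), agreeOn_eq_of_mem h]
      congr 2
      ext w
      simp [agreeOn, and_comm]
    rw [hμ, hν, h1]
    simp only [h2]
    rw [Real.log_div (div_ne_zero (hp _) (hp _))
      (Finset.prod_ne_zero_iff.2 fun j _ => div_ne_zero (hp _) (hp _)),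
      Real.log_prod fun j _ => div_ne_zero (hp _) (hp _), Real.log_div (hp _) (hp _)]
    congr 1
    exact Finset.sum_congr rfl fun j _ => Real.log_div (hp _) (hp _)

lemma sum_measureReal_mul_sum_agreeOn (A : Finset ι) (G : (ι → κ) → ℝ)
    [∀ z : ι → κ, DecidablePred (· ∈ agreeOn A z)] :
    ∑ z, π.real {z} * ∑ y, (if y ∈ agreeOn A z then π.real {y} / π.real (agreeOn A z) else 0) * G y
      = ∑ y, π.real {y} * G y := by
  classical
  simp only [Finset.mul_sum]
  rw [Finset.sum_comm]
  refine Finset.sum_congr rfl fun y _ => ?_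
  have h : ∀ z, π.real {z} * ((if y ∈ agreeOn A z then π.real {y} / π.real (agreeOn A z) else 0) *
      G y) = (if z ∈ agreeOn A y then π.real {z} else 0) *
        (π.real {y} / π.real (agreeOn A y) * G y) := fun z => by
    by_cases hz : y ∈ agreeOn A z
    · have hz' : z ∈ agreeOn A y := fun i hi => (hz i hi).symm
      rw [if_pos hz, if_pos hz', agreeOn_eq_of_mem hz]
    · have hz' : z ∉ agreeOn A y := fun h => hz fun i hi => (h i hi).symm
      rw [if_neg hz, if_neg hz']; ring
  rw [Finset.sum_congr rfl fun z _ => h z, ← Finset.sum_mul, sum_ite_measureReal_singleton]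
  rcases (measureReal_nonneg (μ := π) (s := {y})).eq_or_lt with h0 | h0
  · simp [← h0]
  · have := (measureReal_agreeOn_pos h0 A).ne'
    field_simp

lemma integral_tvDist_cond_sq_le {J : Type*} [Fintype J] (A : Finset ι) (e : J → ι) :
    (∫ z, tvDist (Measure.map (fun y j => y (e j)) (π[|agreeOn A z]))
      (Measure.pi fun j => Measure.map (fun y => y (e j)) (π[|agreeOn A z])) ∂π) ^ 2 ≤
    ∑ j, (coordEntropy π (insert (e j) A) - coordEntropy π A) -
      (coordEntropy π (A ∪ Finset.univ.image e) - coordEntropy π A) := by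
  classical
  rw [integral_fintype (.of_finite)]
  simp only [smul_eq_mul]
  set t : (ι → κ) → ℝ := fun z =>
    tvDist (Measure.map (fun y j => y (e j)) (π[|agreeOn A z]))
      (Measure.pi fun j => Measure.map (fun y => y (e j)) (π[|agreeOn A z])) with ht
  have h1 : (∑ z, π.real {z} * t z) ^ 2 ≤ ∑ z, π.real {z} * t z ^ 2 :=
    Real.pow_arith_mean_le_arith_mean_pow Finset.univ (fun z => π.real {z}) t
      (fun _ _ => measureReal_nonneg) (sum_measureReal_singleton_univ π)
      (fun _ _ => tvDist_nonneg _ _) 2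
  refine h1.trans ((Finset.sum_le_sum fun z _ => ?_).trans_eq
    ((sum_measureReal_mul_sum_agreeOn π A fun y =>
      (Real.log (π.real (agreeOn (A ∪ Finset.univ.image e) y)) - Real.log (π.real (agreeOn A y)) -
        ∑ j, (Real.log (π.real (agreeOn (insert (e j) A) y)) -
          Real.log (π.real (agreeOn A y))))).trans ?_))
  · rcases (measureReal_nonneg (μ := π) (s := {z})).eq_or_lt with h0 | h0
    · simp [← h0]
    · exact mul_le_mul_of_nonneg_left (tvDist_cond_sq_le π A e h0) h0.le
  · simp only [coordEntropy, mul_sub, Finset.sum_sub_distrib, Finset.mul_sum]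
    rw [Finset.sum_comm, Finset.sum_comm (s := Finset.univ (α := ι → κ)),
      Finset.sum_neg_distrib, Finset.sum_neg_distrib]
    ring

end CoordinateEntropy

section RandomOrder

lemma sum_perm_image_eq {ι : Type*} [Fintype ι] [DecidableEq ι] (f : Finset ι → ℝ)
    {S T : Finset ι} (h : S.card = T.card) :
    ∑ σ : Equiv.Perm ι, f (S.image σ) = ∑ σ : Equiv.Perm ι, f (T.image σ) := by
  set τ : Equiv.Perm ι := (Finset.equivOfCardEq h).extendSubtype with hτ
  have hT : S.image τ = T := by
    refine Finset.eq_of_subset_of_card_le (fun x hx => ?_) ?_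
    · obtain ⟨y, hy, rfl⟩ := Finset.mem_image.1 hx
      exact Equiv.extendSubtype_mem _ y hy
    · rw [Finset.card_image_of_injective _ τ.injective, h]
  rw [← hT, ← Equiv.sum_comp (Equiv.mulRight τ)]
  exact Finset.sum_congr rfl fun σ _ => by
    rw [Finset.image_image]
    rfl

/-- The first `j` elements of `Fin n`. -/
def initSeg (n j : ℕ) : Finset (Fin n) := Finset.univ.filter fun i => (i : ℕ) < j

lemma mem_initSeg {n j : ℕ} {i : Fin n} : i ∈ initSeg n j ↔ (i : ℕ) < j := by
  simp [initSeg]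

lemma initSeg_succ {n j : ℕ} (h : j < n) :
    initSeg n (j + 1) = insert ⟨j, h⟩ (initSeg n j) := by
  ext i
  simp only [mem_initSeg, Finset.mem_insert, Fin.ext_iff]
  omega

lemma sum_block_increments_le {G : ℕ → ℝ} (hmono : Monotone G)
    (hconc : ∀ j, G (j + 2) + G j ≤ 2 * G (j + 1)) (m k : ℕ) :
    ∑ r ∈ Finset.range k,
      (m * (G (m * r + 1) - G (m * r)) - (G (m * (r + 1)) - G (m * r))) ≤ m * (G 1 - G 0) := by
  have hanti : Antitone fun j => G (j + 1) - G j :=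
    antitone_nat_of_succ_le fun j => by linarith [hconc j]
  have hinc : ∀ a l : ℕ, l * (G (a + l + 1) - G (a + l)) ≤ G (a + l) - G a := by
    intro a l
    have h : G (a + l) - G a = ∑ i ∈ Finset.range l, (G (a + i + 1) - G (a + i)) :=
      (Finset.sum_range_sub (fun i => G (a + i)) l).symm
    rw [h, ← nsmul_eq_mul]
    simpa using Finset.card_nsmul_le_sum (Finset.range l) (fun i => G (a + i + 1) - G (a + i)) _
      fun i hi => hanti (show a + i ≤ a + l by have := Finset.mem_range.1 hi; omega)
  calc _ ≤ ∑ r ∈ Finset.range k, (m * (G (m * r + 1) - G (m * r)) -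
        m * (G (m * (r + 1) + 1) - G (m * (r + 1)))) :=
        Finset.sum_le_sum fun r _ => by
          have := hinc (m * r) m
          rw [← Nat.mul_succ] at this
          linarith
    _ = m * (G 1 - G 0) - m * (G (m * k + 1) - G (m * k)) := by
        rw [Finset.sum_range_sub' fun r => m * (G (m * r + 1) - G (m * r))]
        simp
    _ ≤ _ := sub_le_self _ (mul_nonneg m.cast_nonneg (sub_nonneg.2 (hmono (Nat.le_succ _))))

variable {n : ℕ} {κ : Type*} [Fintype κ] [MeasurableSpace κ] [MeasurableSingletonClass κ]
  (π : Measure (Fin n → κ)) [IsProbabilityMeasure π]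

lemma sum_perm_coordEntropy_concave (j : ℕ) :
    ∑ σ : Equiv.Perm (Fin n), coordEntropy π ((initSeg n (j + 2)).image σ) +
      ∑ σ : Equiv.Perm (Fin n), coordEntropy π ((initSeg n j).image σ) ≤
    2 * ∑ σ : Equiv.Perm (Fin n), coordEntropy π ((initSeg n (j + 1)).image σ) := by
  rw [two_mul]
  rcases lt_or_ge (j + 1) n with h | h
  · have hj : j < n := by omega
    have hcard : (initSeg n (j + 1)).card = (insert ⟨j + 1, h⟩ (initSeg n j)).card := by
      rw [initSeg_succ hj, Finset.card_insert_of_notMem (by simp [mem_initSeg]),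
        Finset.card_insert_of_notMem (by simp [mem_initSeg])]
    refine le_trans ?_ (congrArg (_ + ·) (sum_perm_image_eq (coordEntropy π) hcard).symm).le
    rw [← Finset.sum_add_distrib, ← Finset.sum_add_distrib, initSeg_succ h, initSeg_succ hj]
    refine Finset.sum_le_sum fun σ _ => ?_
    simp only [Finset.image_insert]
    rw [add_comm (coordEntropy π (insert (σ ⟨j, hj⟩) _))]
    exact coordEntropy_submodular π ((initSeg n j).image σ) (σ ⟨j + 1, h⟩) (σ ⟨j, hj⟩)
  · have h2 : initSeg n (j + 2) = initSeg n (j + 1) := by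
      ext i
      simp only [mem_initSeg]
      omega
    rw [h2]
    gcongr with σ
    refine coordEntropy_mono π (Finset.image_subset_image fun i => ?_)
    simp only [mem_initSeg]
    omega

lemma sum_perm_block_entropy_gap_le {m k : ℕ} (hmk : m * k = n) :
    ∑ r : Fin k, ∑ σ : Equiv.Perm (Fin n),
      (∑ i : {i : Fin n // m * (r : ℕ) ≤ (i : ℕ) ∧ (i : ℕ) < m * ((r : ℕ) + 1)},
        (coordEntropy π (insert (σ i.1) ((initSeg n (m * r)).image σ)) -
          coordEntropy π ((initSeg n (m * r)).image σ)) -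
        (coordEntropy π ((initSeg n (m * (r + 1))).image σ) -
          coordEntropy π ((initSeg n (m * r)).image σ))) ≤
    Fintype.card (Equiv.Perm (Fin n)) * (m * Real.log (Fintype.card κ)) := by
  set G : ℕ → ℝ := fun j => ∑ σ : Equiv.Perm (Fin n), coordEntropy π ((initSeg n j).image σ)
    with hG
  have hmono : Monotone G := fun a b hab => Finset.sum_le_sum fun σ _ =>
    coordEntropy_mono π (Finset.image_subset_image fun i => by
      simp only [mem_initSeg]
      omega)
  have hcard : ∀ r : Fin k, Fintype.card
      {i : Fin n // m * (r : ℕ) ≤ (i : ℕ) ∧ (i : ℕ) < m * ((r : ℕ) + 1)} = m := by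
    intro r
    have hr : m * ((r : ℕ) + 1) ≤ n := hmk ▸ Nat.mul_le_mul_left m r.2
    rw [Fintype.card_subtype, ← Finset.card_image_of_injective _ Fin.val_injective]
    have : (Finset.univ.filter fun i : Fin n =>
        m * (r : ℕ) ≤ (i : ℕ) ∧ (i : ℕ) < m * ((r : ℕ) + 1)).image Fin.val =
        Finset.Ico (m * (r : ℕ)) (m * ((r : ℕ) + 1)) := by
      ext x
      simp only [Finset.mem_image, Finset.mem_filter, Finset.mem_univ, true_and, Finset.mem_Ico]
      exact ⟨fun ⟨i, hi, hx⟩ => hx ▸ hi, fun hx => ⟨⟨x, by omega⟩, hx, rfl⟩⟩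
    rw [this, Nat.card_Ico, Nat.mul_succ]
    omega
  have hterm : ∀ r : Fin k, ∑ σ : Equiv.Perm (Fin n),
      (∑ i : {i : Fin n // m * (r : ℕ) ≤ (i : ℕ) ∧ (i : ℕ) < m * ((r : ℕ) + 1)},
        (coordEntropy π (insert (σ i.1) ((initSeg n (m * r)).image σ)) -
          coordEntropy π ((initSeg n (m * r)).image σ)) -
        (coordEntropy π ((initSeg n (m * (r + 1))).image σ) -
          coordEntropy π ((initSeg n (m * r)).image σ))) =
      m * (G (m * r + 1) - G (m * r)) - (G (m * (r + 1)) - G (m * r)) := by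
    intro r
    rw [Finset.sum_sub_distrib, Finset.sum_sub_distrib, Finset.sum_comm]
    congr 1
    refine (Finset.sum_eq_card_nsmul (b := G (m * r + 1) - G (m * r)) fun i _ => ?_).trans
      (by rw [Finset.card_univ, hcard, nsmul_eq_mul])
    rw [Finset.sum_sub_distrib]
    congr 1
    have hlt : m * (r : ℕ) < n := lt_of_le_of_lt i.2.1 i.1.2
    have hc : (insert i.1 (initSeg n (m * r))).card = (initSeg n (m * r + 1)).card := by
      rw [initSeg_succ hlt, Finset.card_insert_of_notMem (by simp [mem_initSeg, i.2.1]),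
        Finset.card_insert_of_notMem (by simp [mem_initSeg])]
    rw [hG]
    simp only [← Finset.image_insert]
    exact sum_perm_image_eq _ hc
  rw [Finset.sum_congr rfl fun r _ => hterm r, Fin.sum_univ_eq_sum_range fun r =>
    m * (G (m * r + 1) - G (m * r)) - (G (m * (r + 1)) - G (m * r))]
  refine (sum_block_increments_le hmono (sum_perm_coordEntropy_concave π) m k).trans ?_
  rw [mul_left_comm]
  gcongr
  have h0 : G 0 = 0 := by simp [hG, initSeg, coordEntropy_empty]
  rw [h0, sub_zero, hG, ← nsmul_eq_mul, ← Finset.card_univ]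
  refine Finset.sum_le_card_nsmul _ _ _ fun σ _ => ?_
  rcases n.eq_zero_or_pos with hn | hn
  · have : initSeg n 1 = ∅ := by
      subst hn
      rfl
    rw [this, Finset.image_empty, coordEntropy_empty]
    exact Real.log_natCast_nonneg _
  · have : initSeg n 1 = {⟨0, hn⟩} := by
      ext i
      simp [mem_initSeg, Fin.ext_iff]
    rw [this, Finset.image_singleton]
    exact coordEntropy_singleton_le π _

end RandomOrder

/-- Let `π` be a distribution on `[q]^n`, `k ∣ n`, `ñ = n/k`, and for
`r ∈ [k]` let `S_r = {ñ(r-1)+1, …, ñr}` (0-indexed: `ñ·r ≤ i < ñ·(r+1)`). For a uniformly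
random permutation `σ` and `X ∼ π`, let `μ_r` be the conditional joint law of
`(X_{σ(i)})_{i ∈ S_r}` given `(X_{σ(i)})_{i ∈ S_1 ∪ ⋯ ∪ S_{r-1}}` and `ν_r` the product of
the corresponding conditional marginals. Then
`E_σ E_{X∼π} [∑_r dTV(μ_r, ν_r)] ≤ √(n log q)`. -/
theorem expected_tv_product_vs_joint_le_sqrt {n q k : ℕ} (hq : 1 ≤ q) (hk : 1 ≤ k)
    (hdvd : k ∣ n)
    (π : Measure (Fin n → Fin q)) [IsProbabilityMeasure π] :
    (Fintype.card (Equiv.Perm (Fin n)) : ℝ)⁻¹ *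
        ∑ σ : Equiv.Perm (Fin n),
          ∫ z, ∑ r : Fin k,
            tvDist
              (Measure.map
                (fun y => fun i : {i : Fin n // n / k * (r : ℕ) ≤ (i : ℕ) ∧
                    (i : ℕ) < n / k * ((r : ℕ) + 1)} => y (σ i.1))
                (π[|{y | ∀ i : Fin n, (i : ℕ) < n / k * (r : ℕ) → y (σ i) = z (σ i)}]))
              (Measure.pi
                (fun i : {i : Fin n // n / k * (r : ℕ) ≤ (i : ℕ) ∧
                    (i : ℕ) < n / k * ((r : ℕ) + 1)} =>
                  Measure.map (fun y => y (σ i.1))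
                    (π[|{y | ∀ i : Fin n, (i : ℕ) < n / k * (r : ℕ) → y (σ i) = z (σ i)}])))
            ∂π ≤
      Real.sqrt (n * Real.log q) := by
  have hmk : n / k * k = n := Nat.div_mul_cancel hdvd
  set m := n / k with hm
  set N : ℝ := (Fintype.card (Equiv.Perm (Fin n)) : ℝ) with hN
  have hNpos : 0 < N := by simp [hN, Fintype.card_pos]
  set t : Equiv.Perm (Fin n) → Fin k → ℝ := fun σ r => ∫ z, tvDist
      (Measure.map (fun y => fun i : {i : Fin n // m * (r : ℕ) ≤ (i : ℕ) ∧
        (i : ℕ) < m * ((r : ℕ) + 1)} => y (σ i.1))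
        (π[|{y | ∀ i : Fin n, (i : ℕ) < m * (r : ℕ) → y (σ i) = z (σ i)}]))
      (Measure.pi (fun i : {i : Fin n // m * (r : ℕ) ≤ (i : ℕ) ∧
        (i : ℕ) < m * ((r : ℕ) + 1)} => Measure.map (fun y => y (σ i.1))
        (π[|{y | ∀ i : Fin n, (i : ℕ) < m * (r : ℕ) → y (σ i) = z (σ i)}]))) ∂π with ht
  have hsq : ∀ σ r, t σ r ^ 2 ≤
      ∑ i : {i : Fin n // m * (r : ℕ) ≤ (i : ℕ) ∧ (i : ℕ) < m * ((r : ℕ) + 1)},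
        (coordEntropy π (insert (σ i.1) ((initSeg n (m * r)).image σ)) -
          coordEntropy π ((initSeg n (m * r)).image σ)) -
        (coordEntropy π ((initSeg n (m * (r + 1))).image σ) -
          coordEntropy π ((initSeg n (m * r)).image σ)) := by
    intro σ r
    have hagree : ∀ z : Fin n → Fin q,
        {y : Fin n → Fin q | ∀ i : Fin n, (i : ℕ) < m * (r : ℕ) → y (σ i) = z (σ i)} =
        agreeOn ((initSeg n (m * r)).image σ) z := fun z => by
      ext y
      simp [agreeOn, mem_initSeg]
    have hunion : (initSeg n (m * r)).image σ ∪ Finset.univ.image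
        (fun i : {i : Fin n // m * (r : ℕ) ≤ (i : ℕ) ∧ (i : ℕ) < m * ((r : ℕ) + 1)} => σ i.1) =
        (initSeg n (m * (r + 1))).image σ := by
      have hle : m * (r : ℕ) ≤ m * ((r : ℕ) + 1) := Nat.mul_le_mul_left m (Nat.le_succ _)
      ext x
      obtain ⟨i, rfl⟩ := σ.surjective x
      simp only [Finset.mem_union, Finset.mem_image, EmbeddingLike.apply_eq_iff_eq, mem_initSeg,
        exists_eq_right, Finset.mem_univ, true_and, Subtype.exists, exists_prop]
      omega
    simp only [ht, hagree]
    rw [← hunion]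
    exact integral_tvDist_cond_sq_le π _ _
  have hgap : ∑ σ, ∑ r, t σ r ^ 2 ≤ N * (m * Real.log q) := by
    rw [Finset.sum_comm]
    refine (Finset.sum_le_sum fun r _ => Finset.sum_le_sum fun σ _ => hsq σ r).trans ?_
    simpa using sum_perm_block_entropy_gap_le π hmk
  have hcs : (∑ σ, ∑ r, t σ r) ^ 2 ≤ N * k * ∑ σ, ∑ r, t σ r ^ 2 := by
    have := sq_sum_le_card_mul_sum_sq (s := Finset.univ)
      (f := fun x : Equiv.Perm (Fin n) × Fin k => t x.1 x.2)
    rw [Fintype.sum_prod_type, Fintype.sum_prod_type, Finset.card_univ, Fintype.card_prod,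
      Fintype.card_fin, Nat.cast_mul] at this
    exact this
  rw [Finset.sum_congr rfl fun σ _ => integral_finsetSum _ fun r _ => .of_finite]
  refine Real.le_sqrt_of_sq_le ?_
  change (N⁻¹ * ∑ σ, ∑ r, t σ r) ^ 2 ≤ _
  rw [mul_pow, inv_pow, inv_mul_le_iff₀ (by positivity)]
  calc _ ≤ N * k * ∑ σ, ∑ r, t σ r ^ 2 := hcs
    _ ≤ N * k * (N * (m * Real.log q)) := by gcongr
    _ = N ^ 2 * (((m * k : ℕ) : ℝ) * Real.log q) := by
        push_cast
        ring
    _ = _ := by rw [hmk]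
end
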